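/- Theorem 4 (ISSf via PBF). Let E = EuclideanSpace ℝ (Fin n). Let h : E → ℝ be continuously differentiable, let α : ℝ → ℝ be continuous, strictly increasing, surjective onto ℝ, with α(0) = 0, and let ε : ℝ → ℝ be continuously differentiable with ε(r) > 0 and ε'(r) ≥ 0 for all r. Let p > 0 and let f̃ : ℝ → E → E satisfy ‖f̃(t, y)‖ ≤ p for all t ≥ 0, y ∈ E (g̃ ≡ 0). Let h* ∈ ℝ satisfy α(h*) = -ε(h*) p² / 4, and assume h* is a regular value of h. Let k be a feedback controller such that the closed-loop field F(t, y) = f(t,y) + g(t,y)(k(t,y)) + f̃(t,y) is continuous in (t,y) and locally Lipschitz in y, and such that the ISSf-CBF condition ⟪∇h(y), f(t,y) + g(t,y)(k(t,y))⟫ ≥ -α(h(y)) + ‖∇h(y)‖² / ε(h(y)) holds for all t ≥ 0 and all y ∈ E. Then h* < 0, and any trajectory x with x'(t) = F(t, x(t)) for all t ≥ 0 and h(x(0)) ≥ h* satisfies h(x(t)) ≥ h* for all t ≥ 0. -/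

import Mathlib

open scoped RealInnerProductSpace

/-- Theorem 4 (ISSf via PBF): with bounded additive uncertainty `‖f̃‖ ≤ p` and the
ISSf-CBF condition with robustifying term `‖∇h‖²/ε(h)`, the level `h*` defined by
`α h* = -ε h* p²/4` is negative, and trajectories starting in
`S_ISSf = {y | h y ≥ h*}` stay in it. -/
theorem issf_via_pbf
    (n m : ℕ)
    (h : EuclideanSpace ℝ (Fin n) → ℝ) (hh : ContDiff ℝ 1 h)
    (α : ℝ → ℝ) (hαc : Continuous α) (hαm : StrictMono α)
    (hαs : Function.Surjective α) (hα0 : α 0 = 0)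
    (ε : ℝ → ℝ) (hε : ContDiff ℝ 1 ε) (hεpos : ∀ r, 0 < ε r)
    (hε' : ∀ r, 0 ≤ deriv ε r)
    (p : ℝ) (hp : 0 < p)
    (ftil : ℝ → EuclideanSpace ℝ (Fin n) → EuclideanSpace ℝ (Fin n))
    (hftil : ∀ t, 0 ≤ t → ∀ y : EuclideanSpace ℝ (Fin n), ‖ftil t y‖ ≤ p)
    (hstar : ℝ) (hstar_eq : α hstar = -(ε hstar * p ^ 2) / 4)
    (hreg : ∀ y : EuclideanSpace ℝ (Fin n), h y = hstar → gradient h y ≠ 0)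
    (f : ℝ → EuclideanSpace ℝ (Fin n) → EuclideanSpace ℝ (Fin n))
    (g : ℝ → EuclideanSpace ℝ (Fin n) →
      (EuclideanSpace ℝ (Fin m) →L[ℝ] EuclideanSpace ℝ (Fin n)))
    (k : ℝ → EuclideanSpace ℝ (Fin n) → EuclideanSpace ℝ (Fin m))
    (F : ℝ → EuclideanSpace ℝ (Fin n) → EuclideanSpace ℝ (Fin n))
    (hF : ∀ t y, F t y = f t y + g t y (k t y) + ftil t y)
    (hF_cont : Continuous fun q : ℝ × EuclideanSpace ℝ (Fin n) => F q.1 q.2)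
    (hF_lip : ∀ t : ℝ, LocallyLipschitz (F t))
    (hissf : ∀ t, 0 ≤ t → ∀ y : EuclideanSpace ℝ (Fin n),
      -α (h y) + ‖gradient h y‖ ^ 2 / ε (h y) ≤
        ⟪gradient h y, f t y + g t y (k t y)⟫)
    (x : ℝ → EuclideanSpace ℝ (Fin n))
    (hx : ∀ t, 0 ≤ t → HasDerivAt x (F t (x t)) t)
    (h0 : hstar ≤ h (x 0)) :
    hstar < 0 ∧ ∀ t, 0 ≤ t → hstar ≤ h (x t) := by
  have hεm : Monotone ε :=
    monotone_of_deriv_nonneg (hε.differentiable one_ne_zero) hε'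
  refine ⟨?_, ?_⟩
  · have h1 : 0 < ε hstar * p ^ 2 := mul_pos (hεpos _) (pow_pos hp 2)
    have h2 : α hstar < α 0 := by rw [hstar_eq, hα0]; linarith
    exact hαm.lt_iff_lt.mp h2
  -- derivative of `h ∘ x`
  have hd : ∀ t, 0 ≤ t → HasDerivAt (fun s => h (x s)) ⟪gradient h (x t), F t (x t)⟫ t := by
    intro t ht
    have hg : HasGradientAt h (gradient h (x t)) (x t) :=
      ((hh.differentiable one_ne_zero) (x t)).hasGradientAt
    have := hg.hasFDerivAt.comp_hasDerivAt t (hx t ht)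
    exact this
  -- strict positivity below the level
  have hpos : ∀ t, 0 ≤ t → h (x t) < hstar → 0 < ⟪gradient h (x t), F t (x t)⟫ := by
    intro t ht hlt
    have h1 := hissf t ht (x t)
    have h2 : -(‖gradient h (x t)‖ * p) ≤ ⟪gradient h (x t), ftil t (x t)⟫ := by
      have h3 := neg_le_of_abs_le (abs_real_inner_le_norm (gradient h (x t)) (ftil t (x t)))
      have h4 := mul_le_mul_of_nonneg_left (hftil t ht (x t)) (norm_nonneg (gradient h (x t)))
      linarith
    rw [hF, inner_add_right]
    have h5 := hαm hlt
    have h6 := mul_le_mul_of_nonneg_right (hεm hlt.le) (sq_nonneg p)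
    have he := hεpos (h (x t))
    set G := ‖gradient h (x t)‖
    set e := ε (h (x t))
    have h7 : 0 ≤ G ^ 2 / e - G * p + e * p ^ 2 / 4 := by
      have : G ^ 2 / e - G * p + e * p ^ 2 / 4 = (G - e * p / 2) ^ 2 / e := by
        field_simp
        ring
      rw [this]
      positivity
    linarith
  intro T hT
  refine le_of_forall_pos_le_add fun δ hδ => ?_
  have key := image_le_of_deriv_right_lt_deriv_boundary (a := 0) (b := T)
    (f := fun s => -h (x s)) (f' := fun t => -⟪gradient h (x t), F t (x t)⟫)
    (B := fun _ => -hstar + δ) (B' := fun _ => 0)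
    (fun t ht => (hd t ht.1).neg.continuousAt.continuousWithinAt)
    (fun t ht => (hd t ht.1).neg.hasDerivWithinAt)
    (by linarith)
    (fun t => hasDerivAt_const t _)
    (fun t ht heq => by
      have := hpos t ht.1 (by linarith)
      linarith)
    (Set.right_mem_Icc.mpr hT)
  linarith
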